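/- arXiv:2505.14348 — 5 statements merged into one kernel-verified Lean document; each statement's English description precedes it below -/
import Mathlib

section
/- Commutativity of nested stronger eventually operators: for every step relation R on a state type Σ, every relational postcondition Q : Set (Σ × Σ), all n0 n1 : ℕ, and all states s0 s1 : Σ, if s0 ∈ eventuallyN R n0 {s0' | s1 ∈ eventuallyN R n1 {s1' | (s0', s1') ∈ Q}}, then s1 ∈ eventuallyN R n1 {s1' | s0 ∈ eventuallyN R n0 {s0' | (s0', s1') ∈ Q}}. -/
universe u

variable {σ : Type u}

/-- n-fold composition of a step relation. -/
def relIter (R : σ → σ → Prop) : ℕ → σ → σ → Prop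
  | 0, s, s' => s = s'
  | n + 1, s, s'' => ∃ s', R s s' ∧ relIter R n s' s''

/-- The `eventually` operator, defined inductively. -/
inductive EventuallyRel (R : σ → σ → Prop) (Q : Set σ) : σ → Prop
  | base {s : σ} : s ∈ Q → EventuallyRel R Q s
  | step {s : σ} : (∃ s', R s s') → (∀ s', R s s' → EventuallyRel R Q s') →
      EventuallyRel R Q s

/-- The set of states from which `Q` eventually holds. -/
def eventually (R : σ → σ → Prop) (Q : Set σ) : Set σ := {s | EventuallyRel R Q s}

/-- The stronger eventually operator with an explicit number of steps. -/
def eventuallyN (R : σ → σ → Prop) (n : ℕ) (Q : Set σ) : Set σ :=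
  {s | (∀ s', relIter R n s s' → s' ∈ Q) ∧
       (∀ l, l < n → ∀ s', relIter R l s s' → ∃ s'', R s' s'')}

/-- Ordinary unary Hoare triple. -/
def ensures (R : σ → σ → Prop) (P Q : Set σ) (F : Set (σ × σ)) : Prop :=
  ∀ s ∈ P, s ∈ eventually R {s' | s' ∈ Q ∧ (s, s') ∈ F}

/-- Stronger unary Hoare triple with a step function. -/
def ensuresN (R : σ → σ → Prop) (fn : σ → ℕ) (P Q : Set σ) (F : Set (σ × σ)) : Prop :=
  ∀ s ∈ P, s ∈ eventuallyN R (fn s) {s' | s' ∈ Q ∧ (s, s') ∈ F}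

/-- Relational Hoare triple. -/
def ensures2 (R : σ → σ → Prop) (fn0 fn1 : σ → ℕ) (P Q : Set (σ × σ))
    (F : Set ((σ × σ) × (σ × σ))) : Prop :=
  ∀ s0 s1, (s0, s1) ∈ P →
    s0 ∈ eventuallyN R (fn0 s0) {s0' | s1 ∈ eventuallyN R (fn1 s1)
      {s1' | (s0', s1') ∈ Q ∧ ((s0, s1), (s0', s1')) ∈ F}}

/-- If no run of fewer than `n` steps gets stuck, then some run of `n` steps exists. -/
theorem exists_relIter_of_progress {R : σ → σ → Prop} {n : ℕ} {s : σ}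
    (h : ∀ l, l < n → ∀ s', relIter R l s s' → ∃ s'', R s' s'') :
    ∃ s', relIter R n s s' := by
  induction n generalizing s with
  | zero => exact ⟨s, rfl⟩
  | succ n ih =>
    obtain ⟨t, ht⟩ := h 0 n.succ_pos s rfl
    obtain ⟨s', hs'⟩ := ih (s := t) fun l hl s' hs' =>
      h (l + 1) (Nat.succ_lt_succ hl) s' ⟨t, ht, hs'⟩
    exact ⟨s', t, ht, hs'⟩

theorem eventuallyN_comm (R : σ → σ → Prop) (Q : Set (σ × σ)) (n0 n1 : ℕ) (s0 s1 : σ)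
    (h : s0 ∈ eventuallyN R n0 {s0' | s1 ∈ eventuallyN R n1 {s1' | (s0', s1') ∈ Q}}) :
    s1 ∈ eventuallyN R n1 {s1' | s0 ∈ eventuallyN R n0 {s0' | (s0', s1') ∈ Q}} := by
  obtain ⟨hpost, hprog⟩ := h
  obtain ⟨t0, ht0⟩ := exists_relIter_of_progress hprog
  exact ⟨fun s1' h1 => ⟨fun s0' h0 => (hpost s0' h0).1 s1' h1, hprog⟩, (hpost t0 ht0).2⟩
end

section
/- For deterministic semantics the ordinary Hoare triple can be strengthened: for every step relation R on a state type Σ that is deterministic (∀ s s1 s2, R s s1 → R s s2 → s1 = s2), all P Q : Set Σ, and every frame F : Set (Σ × Σ), if ensures R P Q F holds then there exists a step function fn : Σ → ℕ such that ensuresN R fn P Q F holds. -/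
universe u

variable {σ : Type u}

/-- For a deterministic step relation, `eventually` is witnessed by a number of steps. -/
theorem EventuallyRel.exists_mem_eventuallyN {R : σ → σ → Prop}
    (hdet : ∀ s s1 s2, R s s1 → R s s2 → s1 = s2) {Q : Set σ} {s : σ}
    (h : EventuallyRel R Q s) : ∃ n, s ∈ eventuallyN R n Q := by
  induction h with
  | base hs =>
    refine ⟨0, fun s' hs' => ?_, fun l hl => absurd hl (Nat.not_lt_zero l)⟩
    cases hs'
    exact hs
  | @step s hex _ ih =>
    obtain ⟨t, ht⟩ := hex
    obtain ⟨n, hQ, hsafe⟩ := ih t ht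
    refine ⟨n + 1, ?_, ?_⟩
    · rintro s' ⟨u, hu, hs'⟩
      obtain rfl := hdet s t u ht hu
      exact hQ s' hs'
    · rintro (_ | l) hl s' hs'
      · cases hs'
        exact ⟨t, ht⟩
      · obtain ⟨u, hu, hs'⟩ := hs'
        obtain rfl := hdet s t u ht hu
        exact hsafe l (Nat.lt_of_succ_lt_succ hl) s' hs'

theorem ensures_imp_ensuresN_of_deterministic (R : σ → σ → Prop)
    (hdet : ∀ s s1 s2, R s s1 → R s s2 → s1 = s2)
    (P Q : Set σ) (F : Set (σ × σ)) (h : ensures R P Q F) :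
    ∃ fn : σ → ℕ, ensuresN R fn P Q F := by
  have hex : ∀ s, ∃ n, s ∈ P → s ∈ eventuallyN R n {s' | s' ∈ Q ∧ (s, s') ∈ F} := by
    intro s
    by_cases hs : s ∈ P
    · obtain ⟨n, hn⟩ := EventuallyRel.exists_mem_eventuallyN hdet (h s hs)
      exact ⟨n, fun _ => hn⟩
    · exact ⟨0, fun hs' => absurd hs' hs⟩
  choose fn hfn using hex
  exact ⟨fn, hfn⟩
end

section
/- Transitive composition of relational Hoare triples: for every step relation R on a state type Σ, relational conditions P Rmid Q : Set (Σ × Σ), relational frames F0 F1 : Set ((Σ × Σ) × (Σ × Σ)), and natural numbers n0 n1 m0 m1, if ensures2 R (fun _ => n0) (fun _ => m0) P Rmid F0 and ensures2 R (fun _ => n1) (fun _ => m1) Rmid Q F1 hold, then ensures2 R (fun _ => n0 + n1) (fun _ => m0 + m1) P Q (F0 ∘ F1) holds, where F0 ∘ F1 := {(p, p'') | ∃ p', (p, p') ∈ F0 ∧ (p', p'') ∈ F1}. -/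
universe u

variable {σ : Type u}

theorem relIter_add {R : σ → σ → Prop} {m n : ℕ} {s s'' : σ} :
    relIter R (m + n) s s'' ↔ ∃ s', relIter R m s s' ∧ relIter R n s' s'' := by
  induction m generalizing s with
  | zero => simp [relIter]
  | succ m ih =>
    rw [Nat.succ_add]
    simp only [relIter, ih]
    constructor
    · rintro ⟨t, ht, u, hu, hus⟩
      exact ⟨u, ⟨t, ht, hu⟩, hus⟩
    · rintro ⟨u, ⟨t, ht, hu⟩, hus⟩
      exact ⟨t, ht, u, hu, hus⟩

theorem eventuallyN_mono {R : σ → σ → Prop} {n : ℕ} {Q Q' : Set σ} (h : Q ⊆ Q') :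
    eventuallyN R n Q ⊆ eventuallyN R n Q' :=
  fun _ hs => ⟨fun s' hs' => h (hs.1 s' hs'), hs.2⟩

theorem Set.Nonempty.of_eventuallyN {R : σ → σ → Prop} {n : ℕ} {Q : Set σ} {s : σ}
    (h : s ∈ eventuallyN R n Q) : Q.Nonempty :=
  let ⟨t, ht⟩ := exists_relIter_of_progress h.2
  ⟨t, h.1 t ht⟩

theorem eventuallyN_add {R : σ → σ → Prop} {m n : ℕ} {Q : Set σ} {s : σ}
    (h : s ∈ eventuallyN R m (eventuallyN R n Q)) : s ∈ eventuallyN R (m + n) Q := by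
  refine ⟨fun u hu => ?_, fun l hl u hu => ?_⟩
  · obtain ⟨t, ht, htu⟩ := relIter_add.1 hu
    exact (h.1 t ht).1 u htu
  · rcases lt_or_ge l m with hlm | hml
    · exact h.2 l hlm u hu
    · obtain ⟨k, rfl⟩ := Nat.exists_eq_add_of_le hml
      obtain ⟨t, ht, htu⟩ := relIter_add.1 hu
      exact (h.1 t ht).2 k (Nat.lt_of_add_lt_add_left hl) u htu

theorem ensures2_trans (R : σ → σ → Prop) (P Rmid Q : Set (σ × σ))
    (F0 F1 : Set ((σ × σ) × (σ × σ))) (n0 n1 m0 m1 : ℕ)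
    (h1 : ensures2 R (fun _ => n0) (fun _ => m0) P Rmid F0)
    (h2 : ensures2 R (fun _ => n1) (fun _ => m1) Rmid Q F1) :
    ensures2 R (fun _ => n0 + n1) (fun _ => m0 + m1) P Q
      {pq | ∃ p', (pq.1, p') ∈ F0 ∧ (p', pq.2) ∈ F1} := by
  intro s0 s1 hP
  refine eventuallyN_add (eventuallyN_mono ?_ (h1 s0 s1 hP))
  intro t0 (ht0 : s1 ∈ eventuallyN R m0 _)
  obtain ⟨t1, ht1, -⟩ := Set.Nonempty.of_eventuallyN ht0
  refine ⟨fun u0 hu0 => eventuallyN_add (eventuallyN_mono ?_ ht0), (h2 t0 t1 ht1).2⟩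
  rintro v1 ⟨hmid, hF0⟩
  refine eventuallyN_mono ?_ ((h2 t0 v1 hmid).1 u0 hu0)
  rintro u1 ⟨hQ, hF1⟩
  exact ⟨hQ, (t0, v1), hF0, hF1⟩
end

section
/- Transfer of correctness through equivalence (core): for every step relation R on a state type Σ, step functions fn0 fn1 : Σ → ℕ, unary conditions P Q : Set Σ with unary frame F : Set (Σ × Σ), relational conditions Pr Qr : Set (Σ × Σ), and relational frame Fr : Set ((Σ × Σ) × (Σ × Σ)), if ensuresN R fn0 P Q F and ensures2 R fn0 fn1 Pr Qr Fr hold, then ensures2 R fn0 fn1 {(s0, s1) ∈ Pr | s0 ∈ P} {(s0, s1) ∈ Qr | s0 ∈ Q} {((s0, s1), (s0', s1')) ∈ Fr | (s0, s0') ∈ F} holds. -/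
universe u

variable {σ : Type u}

theorem correctness_transfer (R : σ → σ → Prop) (fn0 fn1 : σ → ℕ)
    (P Q : Set σ) (F : Set (σ × σ)) (Pr Qr : Set (σ × σ))
    (Fr : Set ((σ × σ) × (σ × σ)))
    (h1 : ensuresN R fn0 P Q F) (h2 : ensures2 R fn0 fn1 Pr Qr Fr) :
    ensures2 R fn0 fn1 {p ∈ Pr | p.1 ∈ P} {p ∈ Qr | p.1 ∈ Q}
      {q ∈ Fr | (q.1.1, q.2.1) ∈ F} := by
  rintro s0 s1 ⟨hPr, hP⟩
  obtain ⟨hpost0, hsafe0⟩ := h2 s0 s1 hPr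
  refine ⟨fun s0' hs0' => ?_, hsafe0⟩
  obtain ⟨hQ, hF⟩ := (h1 s0 hP).1 s0' hs0'
  obtain ⟨hpost1, hsafe1⟩ := hpost0 s0' hs0'
  refine ⟨fun s1' hs1' => ?_, hsafe1⟩
  obtain ⟨hQr, hFr⟩ := hpost1 s1' hs1'
  exact ⟨⟨hQr, hQ⟩, ⟨hFr, hF⟩⟩
end

section
/- Frame rule for unary Hoare triples: for every step relation R on a state type Σ, conditions P Q S : Set Σ, and frame F : Set (Σ × Σ), if S is invariant under F (i.e., for all s s', (s, s') ∈ F implies (s ∈ S ↔ s' ∈ S)), then ensures R P Q F implies ensures R (P ∩ S) (Q ∩ S) F. -/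
universe u

variable {σ : Type u}

theorem EventuallyRel.mono {R : σ → σ → Prop} {Q Q' : Set σ} (hQ : Q ⊆ Q') {s : σ}
    (h : EventuallyRel R Q s) : EventuallyRel R Q' s := by
  induction h with
  | base hs => exact .base (hQ hs)
  | step hex _ ih => exact .step hex ih

theorem ensures_frame_rule (R : σ → σ → Prop) (P Q S : Set σ) (F : Set (σ × σ))
    (hS : ∀ s s', (s, s') ∈ F → (s ∈ S ↔ s' ∈ S))
    (h : ensures R P Q F) : ensures R (P ∩ S) (Q ∩ S) F := by
  intro s hs
  refine EventuallyRel.mono ?_ (h s hs.1)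
  rintro s' ⟨hQ, hF⟩
  exact ⟨⟨hQ, (hS s s' hF).1 hs.2⟩, hF⟩
end
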